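/- For every partition λ with at most n parts, the interpolation ASEP polynomials {f*_μ : μ ∈ S_n(λ)} form a K-basis of V*_λ; consequently, {f*_μ : μ ∈ ℕ^n} is a K-basis of 𝒫_n. -/

import Mathlib

open MvPolynomial

noncomputable section
open scoped Classical

/-- The field `K = ℚ(q,t)`. -/
abbrev K : Type := FractionRing (MvPolynomial (Fin 2) ℚ)

/-- The indeterminate `q` as an element of `K`. -/
def qq : K := algebraMap (MvPolynomial (Fin 2) ℚ) K (X 0)

/-- The indeterminate `t` as an element of `K`. -/
def tt : K := algebraMap (MvPolynomial (Fin 2) ℚ) K (X 1)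

/-- The size `|ν|` of a composition. -/
def csize {n : ℕ} (ν : Fin n → ℕ) : ℕ := ∑ i, ν i

/-- `k_i(ν) = #{j < i : ν_j > ν_i} + #{j > i : ν_j ≥ ν_i}`. -/
def kstat {n : ℕ} (ν : Fin n → ℕ) (i : Fin n) : ℕ :=
  Set.ncard {j : Fin n | j < i ∧ ν i < ν j} + Set.ncard {j : Fin n | i < j ∧ ν i ≤ ν j}

/-- The evaluation point `ν̃ = (q^{ν_i} t^{-k_i(ν)})_i`. -/
def evalPt {n : ℕ} (ν : Fin n → ℕ) : Fin n → K :=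
  fun i => qq ^ ν i * tt ^ (-(kstat ν i : ℤ))

/-- Weakly decreasing composition. -/
def IsPartition {n : ℕ} (l : Fin n → ℕ) : Prop := ∀ i j : Fin n, i ≤ j → l j ≤ l i

/-- The action `σ·μ := μ ∘ σ⁻¹`. -/
def permAct {n : ℕ} (σ : Equiv.Perm (Fin n)) (μ : Fin n → ℕ) : Fin n → ℕ := μ ∘ ⇑σ.symm

/-- `S_n(λ)`: the rearrangements of `λ`. -/
def Sn {n : ℕ} (l : Fin n → ℕ) : Set (Fin n → ℕ) :=
  {μ | ∃ σ : Equiv.Perm (Fin n), permAct σ l = μ}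

/-- The rearrangements of `λ` as a `Finset`. -/
def SnFinset {n : ℕ} (l : Fin n → ℕ) : Finset (Fin n → ℕ) :=
  Finset.image (fun σ : Equiv.Perm (Fin n) => permAct σ l) Finset.univ

/-- The exponent `Finsupp` of the monomial `x^μ`. -/
def expOf {n : ℕ} (μ : Fin n → ℕ) : Fin n →₀ ℕ := Finsupp.equivFunOnFinite.symm μ

/-- Characterization of the interpolation nonsymmetric Macdonald polynomial `E*_μ`. -/
def IsEstar {n : ℕ} (μ : Fin n → ℕ) (f : MvPolynomial (Fin n) K) : Prop :=
  f.totalDegree ≤ csize μ ∧ coeff (expOf μ) f = 1 ∧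
    ∀ ν : Fin n → ℕ, csize ν ≤ csize μ → ν ≠ μ → eval (evalPt ν) f = 0

/-- The interpolation nonsymmetric Macdonald polynomial `E*_μ` (unique by Knop–Sahi). -/
def Estar {n : ℕ} (μ : Fin n → ℕ) : MvPolynomial (Fin n) K :=
  if h : ∃ f, IsEstar μ f then h.choose else 0

/-- Characterization of the interpolation (symmetric) Macdonald polynomial `P*_λ`. -/
def IsPstar {n : ℕ} (l : Fin n → ℕ) (f : MvPolynomial (Fin n) K) : Prop :=
  f.IsSymmetric ∧ f.totalDegree ≤ csize l ∧ coeff (expOf l) f = 1 ∧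
    ∀ ν : Fin n → ℕ, IsPartition ν → csize ν ≤ csize l → ν ≠ l → eval (evalPt ν) f = 0

/-- The interpolation Macdonald polynomial `P*_λ`. -/
def Pstar {n : ℕ} (l : Fin n → ℕ) : MvPolynomial (Fin n) K :=
  if h : ∃ f, IsPstar l f then h.choose else 0

/-- The space `V*_λ`. -/
def Vstar {n : ℕ} (l : Fin n → ℕ) : Submodule K (MvPolynomial (Fin n) K) :=
  (restrictTotalDegree (Fin n) K (csize l)) ⊓
    ⨅ (ν : Fin n → ℕ) (_ : csize ν ≤ csize l ∧ ν ∉ Sn l),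
      LinearMap.ker (aeval (R := K) (evalPt ν)).toLinearMap

/-- Exchange of the variables `x_i` and `x_j` in a polynomial. -/
def swapVars {n : ℕ} (i j : Fin n) (f : MvPolynomial (Fin n) K) : MvPolynomial (Fin n) K :=
  rename (Equiv.swap i j) f

/-- Exact division of polynomials: the unique `g` with `a = b * g` when it exists. -/
def exactDiv {n : ℕ} (a b : MvPolynomial (Fin n) K) : MvPolynomial (Fin n) K :=
  if h : ∃ g, a = b * g then h.choose else 0

/-- The Hecke operator
`T f = t f − ((t x_i − x_j)/(x_i − x_j))·(f − s_i f)` (where `j = i+1`). -/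
def hecke {n : ℕ} (i j : Fin n) (f : MvPolynomial (Fin n) K) : MvPolynomial (Fin n) K :=
  C tt * f - (C tt * X i - X j) * exactDiv (f - swapVars i j f) (X i - X j)

/-- The Coxeter length of a permutation (number of inversions). -/
def permLength {n : ℕ} (σ : Equiv.Perm (Fin n)) : ℕ :=
  Set.ncard {p : Fin n × Fin n | p.1 < p.2 ∧ σ p.2 < σ p.1}

/-- The adjacent transposition `s_i = (i, i+1)` (0-indexed). -/
def adjSwap {n : ℕ} (i : {i : ℕ // i + 1 < n}) : Equiv.Perm (Fin n) :=
  Equiv.swap ⟨i.1, Nat.lt_of_succ_lt i.2⟩ ⟨i.1 + 1, i.2⟩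

/-- The Hecke operator `T_i` for an adjacent transposition index. -/
def heckeAt {n : ℕ} (i : {i : ℕ // i + 1 < n}) :
    MvPolynomial (Fin n) K → MvPolynomial (Fin n) K :=
  hecke ⟨i.1, Nat.lt_of_succ_lt i.2⟩ ⟨i.1 + 1, i.2⟩

/-- `T_{i_1} ⋯ T_{i_ℓ} f` for a word `w = [i_1, …, i_ℓ]`. -/
def Tword {n : ℕ} (w : List {i : ℕ // i + 1 < n}) (f : MvPolynomial (Fin n) K) :
    MvPolynomial (Fin n) K :=
  w.foldr heckeAt f

/-- `w` is a reduced word for `σ`. -/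
def IsReducedWordOf {n : ℕ} (w : List {i : ℕ // i + 1 < n}) (σ : Equiv.Perm (Fin n)) : Prop :=
  (w.map adjSwap).prod = σ ∧ w.length = permLength σ

/-- `T_σ`, computed from a reduced word of `σ` (independent of the choice, by the
Hecke algebra relations). -/
def Tsigma {n : ℕ} (σ : Equiv.Perm (Fin n)) :
    MvPolynomial (Fin n) K → MvPolynomial (Fin n) K :=
  if h : ∃ w, IsReducedWordOf w σ then Tword h.choose else id

/-- `σ_μ`: the (unique) shortest permutation with `σ·l = μ`. -/
def sigmaMin {n : ℕ} (l μ : Fin n → ℕ) : Equiv.Perm (Fin n) :=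
  if h : ∃ σ, permAct σ l = μ ∧ ∀ τ, permAct τ l = μ → permLength σ ≤ permLength τ then
    h.choose else 1

/-- The weakly decreasing rearrangement of a composition. -/
def sortDesc {n : ℕ} (μ : Fin n → ℕ) : Fin n → ℕ :=
  if h : ∃ l, IsPartition l ∧ μ ∈ Sn l then h.choose else μ

/-- The interpolation ASEP polynomial `f*_μ = T_{σ_μ} E*_λ`, where `λ` is the weakly
decreasing rearrangement of `μ`. -/
def fstar {n : ℕ} (μ : Fin n → ℕ) : MvPolynomial (Fin n) K :=
  Tsigma (sigmaMin (sortDesc μ) μ) (Estar (sortDesc μ))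

/-- The composition with entries `i` and `j` exchanged. -/
def swapEntries {n : ℕ} (i j : Fin n) (μ : Fin n → ℕ) : Fin n → ℕ := μ ∘ ⇑(Equiv.swap i j)

/-! ### Interpolation -/

abbrev CI (n d : ℕ) : Type := {ν : Fin n → ℕ // csize ν ≤ d}

lemma finite_csize (n d : ℕ) : {ν : Fin n → ℕ | csize ν ≤ d}.Finite := by
  refine (Set.finite_Iic (fun _ : Fin n => d)).subset ?_
  intro ν hν i
  exact (Finset.single_le_sum (f := ν) (fun _ _ => Nat.zero_le _) (Finset.mem_univ i)).trans hν

instance instFintypeCI (n d : ℕ) : Fintype (CI n d) := (finite_csize n d).fintype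

lemma degree_expOf {n : ℕ} (μ : Fin n → ℕ) : (expOf μ).degree = csize μ := by
  simp [Finsupp.degree_eq_sum, expOf, csize]

lemma expOf_inj {n : ℕ} {μ ν : Fin n → ℕ} : expOf μ = expOf ν ↔ μ = ν := by
  simp [expOf]

lemma expOf_coe {n : ℕ} (m : Fin n →₀ ℕ) : expOf (m : Fin n → ℕ) = m := by
  simp [expOf]

lemma csize_coe {n : ℕ} (m : Fin n →₀ ℕ) : csize (m : Fin n → ℕ) = m.degree := by
  rw [← degree_expOf, expOf_coe]

lemma expand_poly {n d : ℕ} {F : Type*} [Field F] (g : MvPolynomial (Fin n) F)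
    (hg : g.totalDegree ≤ d) :
    g = ∑ α : CI n d, monomial (expOf α.1) (coeff (expOf α.1) g) := by
  ext m
  rw [coeff_sum]
  simp only [coeff_monomial]
  by_cases hm : csize (m : Fin n → ℕ) ≤ d
  · rw [Finset.sum_eq_single (⟨m, hm⟩ : CI n d)]
    · simp [expOf_coe]
    · intro b _ hb
      rw [if_neg]
      intro h
      apply hb
      apply Subtype.ext
      rw [← expOf_inj, h, expOf_coe]
    · simp
  · rw [Finset.sum_eq_zero]
    · apply coeff_eq_zero_of_totalDegree_lt
      rw [csize_coe, Finsupp.degree_apply] at hm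
      exact lt_of_le_of_lt hg (not_le.mp hm)
    · intro b _
      rw [if_neg]
      intro h
      apply hm
      rw [csize_coe, ← h, degree_expOf]
      exact b.2

/-- Row functionals: evaluation at `pt ν`, or the coefficient of `x^ν` if `s ν`. -/
def rowL {n : ℕ} {F : Type*} [Field F] (s : (Fin n → ℕ) → Prop) (pt : (Fin n → ℕ) → Fin n → F)
    (ν : Fin n → ℕ) : MvPolynomial (Fin n) F →ₗ[F] F :=
  if s ν then lcoeff F (expOf ν) else (aeval (R := F) (pt ν)).toLinearMap

lemma rowL_pos {n : ℕ} {F : Type*} [Field F] {s : (Fin n → ℕ) → Prop}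
    {pt : (Fin n → ℕ) → Fin n → F} {ν : Fin n → ℕ} (h : s ν) (g : MvPolynomial (Fin n) F) :
    rowL s pt ν g = coeff (expOf ν) g := by
  simp [rowL, h, lcoeff]

lemma rowL_neg {n : ℕ} {F : Type*} [Field F] {s : (Fin n → ℕ) → Prop}
    {pt : (Fin n → ℕ) → Fin n → F} {ν : Fin n → ℕ} (h : ¬ s ν) (g : MvPolynomial (Fin n) F) :
    rowL s pt ν g = eval (pt ν) g := by
  simp [rowL, h, aeval_eq_eval]

/-- The matrix of the row functionals in the monomial basis. -/
def rowM {n : ℕ} {F : Type*} [Field F] (d : ℕ) (s : (Fin n → ℕ) → Prop)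
    (pt : (Fin n → ℕ) → Fin n → F) : Matrix (CI n d) (CI n d) F :=
  fun ν α => rowL s pt ν.1 (monomial (expOf α.1) 1)

lemma rowM_mulVec {n d : ℕ} {F : Type*} [Field F] (s : (Fin n → ℕ) → Prop)
    (pt : (Fin n → ℕ) → Fin n → F) (c : CI n d → F) (ν : CI n d) :
    (rowM d s pt).mulVec c ν = rowL s pt ν.1 (∑ α : CI n d, monomial (expOf α.1) (c α)) := by
  rw [map_sum]
  apply Finset.sum_congr rfl
  intro α _
  have : monomial (expOf α.1) (c α) = c α • (monomial (expOf α.1) 1 : MvPolynomial (Fin n) F) := by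
    rw [smul_monomial, smul_eq_mul, mul_one]
  rw [this, map_smul, smul_eq_mul, mul_comm]
  rfl

/-- The interpolation polynomial at `t = 1`. -/
def gpoly {n : ℕ} (μ : Fin n → ℕ) : MvPolynomial (Fin n) ℚ :=
  ∏ i, ∏ k ∈ Finset.range (μ i), (X i - C (2 ^ k : ℚ))

def pt1 {n : ℕ} (ν : Fin n → ℕ) : Fin n → ℚ := fun i => 2 ^ ν i

lemma eval_gpoly {n : ℕ} (μ ν : Fin n → ℕ) :
    eval (pt1 ν) (gpoly μ) = ∏ i, ∏ k ∈ Finset.range (μ i), ((2 : ℚ) ^ ν i - 2 ^ k) := by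
  simp [gpoly, pt1]

lemma two_pow_sub_ne {a b : ℕ} (h : a ≠ b) : (2 : ℚ) ^ a - 2 ^ b ≠ 0 := by
  intro h'
  apply h
  have := sub_eq_zero.mp h'
  exact pow_right_injective₀ (by norm_num) (by norm_num) this

lemma eval_gpoly_self {n : ℕ} (μ : Fin n → ℕ) : eval (pt1 μ) (gpoly μ) ≠ 0 := by
  rw [eval_gpoly]
  refine Finset.prod_ne_zero_iff.mpr fun i _ => Finset.prod_ne_zero_iff.mpr fun k hk => ?_
  exact two_pow_sub_ne (Finset.mem_range.mp hk).ne'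

lemma eval_gpoly_zero {n : ℕ} {μ ν : Fin n → ℕ} (h : csize ν ≤ csize μ) (hne : ν ≠ μ) :
    eval (pt1 ν) (gpoly μ) = 0 := by
  rw [eval_gpoly]
  have : ∃ i, ν i < μ i := by
    by_contra hc
    push Not at hc
    apply hne
    have h2 : ∑ i, μ i = ∑ i, ν i := le_antisymm (Finset.sum_le_sum fun i _ => hc i) h
    rw [Finset.sum_eq_sum_iff_of_le (fun i _ => hc i)] at h2
    funext i
    exact (h2 i (Finset.mem_univ i)).symm
  obtain ⟨i, hi⟩ := this
  apply Finset.prod_eq_zero (Finset.mem_univ i)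
  apply Finset.prod_eq_zero (Finset.mem_range.mpr hi)
  simp

lemma totalDegree_gpoly {n : ℕ} (μ : Fin n → ℕ) : (gpoly μ).totalDegree ≤ csize μ := by
  refine (totalDegree_finsetProd _ _).trans (Finset.sum_le_sum fun i _ => ?_)
  refine (totalDegree_finsetProd _ _).trans ?_
  refine (Finset.sum_le_card_nsmul _ _ 1 fun k _ => ?_).trans (by simp)
  exact (totalDegree_sub_C_le _ _).trans (by simp)

lemma coeff_gpoly {n : ℕ} (μ : Fin n → ℕ) : coeff (expOf μ) (gpoly μ) = 1 := by
  have hm : MonomialOrder.lex.Monic (gpoly μ) :=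
    MonomialOrder.Monic.prod fun i _ => MonomialOrder.Monic.prod fun k _ =>
      MonomialOrder.monic_X_sub_C _ _ _
  have hd : MonomialOrder.lex.degree (gpoly μ) = expOf μ := by
    rw [gpoly, MonomialOrder.degree_prod_of_regular]
    · have : ∀ i, MonomialOrder.lex.degree
          (∏ k ∈ Finset.range (μ i), (X i - C (2 ^ k : ℚ)) : MvPolynomial (Fin n) ℚ) =
            Finsupp.single i (μ i) := by
        intro i
        rw [MonomialOrder.degree_prod_of_regular]
        · rw [Finset.sum_congr rfl fun k _ => MonomialOrder.degree_X_sub_C _ _ _]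
          simp
        · intro k _
          rw [(MonomialOrder.monic_X_sub_C MonomialOrder.lex i _).leadingCoeff_eq_one]
          exact isRegular_one
      simp only [this]
      ext j
      simp [expOf, Finsupp.single_apply]
    · intro i _
      rw [(MonomialOrder.Monic.prod fun k _ =>
        MonomialOrder.monic_X_sub_C MonomialOrder.lex i _).leadingCoeff_eq_one]
      exact isRegular_one
  have := hm.leadingCoeff_eq_one
  rwa [MonomialOrder.leadingCoeff, hd] at this

lemma det_rowM_one {n d : ℕ} (s : (Fin n → ℕ) → Prop) (hs : ∀ ν, s ν → csize ν = d)
    (hss : ∀ ν ν', s ν → s ν' → ν = ν') : (rowM d s (pt1 (n := n))).det ≠ 0 := by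
  intro h0
  obtain ⟨v, hv0, hv⟩ := Matrix.exists_vecMul_eq_zero_iff.mpr h0
  have key : ∀ g : MvPolynomial (Fin n) ℚ, g.totalDegree ≤ d →
      ∑ ν : CI n d, v ν * rowL s pt1 ν.1 g = 0 := by
    intro g hg
    rw [expand_poly g hg]
    simp only [map_sum, Finset.mul_sum]
    rw [Finset.sum_comm]
    apply Finset.sum_eq_zero
    intro α _
    have h1 := congrFun hv α
    simp only [Matrix.vecMul, dotProduct, rowM, Pi.zero_apply] at h1
    calc _ = coeff (expOf α.1) g * ∑ ν : CI n d, v ν * rowL s pt1 ν.1 (monomial (expOf α.1) 1) := by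
          rw [Finset.mul_sum]
          apply Finset.sum_congr rfl
          intro ν _
          conv_lhs => rw [← mul_one (coeff (expOf α.1) g), ← smul_eq_mul (coeff (expOf α.1) g) 1,
            ← smul_monomial, map_smul]
          rw [smul_eq_mul]
          ring
      _ = 0 := by rw [h1, mul_zero]
  have hvs : ∀ ν : CI n d, s ν.1 → v ν = 0 := by
    intro μ hμ
    have h1 := key (gpoly μ.1) ((totalDegree_gpoly _).trans μ.2)
    rw [Finset.sum_eq_single μ] at h1
    · rwa [rowL_pos hμ, coeff_gpoly, mul_one] at h1
    · intro ν _ hν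
      have hne : ν.1 ≠ μ.1 := fun h => hν (Subtype.ext h)
      rw [rowL_neg (fun h => hne (hss _ _ h hμ)), eval_gpoly_zero _ hne, mul_zero]
      rw [hs _ hμ]; exact ν.2
    · simp
  obtain ⟨ν0, hν0⟩ := Function.ne_iff.mp hv0
  obtain ⟨μ, hμ, hmax⟩ := Finset.exists_max_image (Finset.univ.filter fun ν : CI n d => v ν ≠ 0)
    (fun ν => csize ν.1) ⟨ν0, by simpa using hν0⟩
  simp only [Finset.mem_filter, Finset.mem_univ, true_and] at hμ hmax
  have h1 := key (gpoly μ.1) ((totalDegree_gpoly _).trans μ.2)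
  rw [Finset.sum_eq_single μ] at h1
  · rw [rowL_neg (fun h => hμ (hvs _ h))] at h1
    exact (mul_ne_zero hμ (eval_gpoly_self _)) h1
  · intro ν _ hν
    by_cases hz : v ν = 0
    · rw [hz, zero_mul]
    · have hne : ν.1 ≠ μ.1 := fun h => hν (Subtype.ext h)
      rw [rowL_neg (fun h => hz (hvs _ h)), eval_gpoly_zero (hmax ν hz) hne, mul_zero]
  · simp

lemma qq_ne : qq ≠ 0 := by
  simp [qq, X_ne_zero]

lemma tt_ne : tt ≠ 0 := by
  simp [tt, X_ne_zero]

/-- The polynomial version of the matrix, scaled by `t^{dn}`. -/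
def rowN {n : ℕ} (d : ℕ) (s : (Fin n → ℕ) → Prop) :
    Matrix (CI n d) (CI n d) (MvPolynomial (Fin 2) ℚ) :=
  fun ν α => if s ν.1 then (if α = ν then X 1 ^ (d * n) else 0) else
    X 0 ^ (∑ i, ν.1 i * α.1 i) * X 1 ^ (d * n - ∑ i, kstat ν.1 i * α.1 i)

def phi : MvPolynomial (Fin 2) ℚ →+* ℚ := eval ![2, 1]

lemma kstat_eq {n : ℕ} (ν : Fin n → ℕ) (i : Fin n) :
    kstat ν i = Set.ncard {j : Fin n | ν i < ν j ∨ (i < j ∧ ν i = ν j)} := by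
  rw [kstat, ← Set.ncard_union_eq]
  · congr 1
    ext j
    simp only [Set.mem_union, Set.mem_ofPred_eq]
    rcases lt_trichotomy i j with h | h | h
    · have := h.le.not_gt
      simp [h, this, le_iff_lt_or_eq]
    · subst h; simp
    · have := h.le.not_gt
      simp [h, this]
  · rw [Set.disjoint_left]
    rintro j ⟨h, _⟩ ⟨h', _⟩
    exact lt_asymm h h'

lemma kstat_le {n : ℕ} (ν : Fin n → ℕ) (i : Fin n) : kstat ν i ≤ n := by
  rw [kstat_eq]
  exact (Set.ncard_le_card _).trans (by simp)

lemma rowL_monomial_eval {n : ℕ} {F : Type*} [Field F] (p : Fin n → F) (α : Fin n → ℕ) :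
    eval p (monomial (expOf α) 1) = ∏ i, p i ^ α i := by
  rw [eval_monomial, one_mul, Finsupp.prod_fintype _ _ (by simp)]
  rfl

lemma rowN_phi {n d : ℕ} (s : (Fin n → ℕ) → Prop) :
    (rowN (n := n) d s).map phi = rowM d s pt1 := by
  ext ν α
  simp only [Matrix.map_apply, rowN, rowM]
  by_cases h : s ν.1
  · rw [if_pos h, rowL_pos h, coeff_monomial]
    by_cases h2 : α = ν
    · simp [h2, phi]
    · have : expOf α.1 ≠ expOf ν.1 := fun h3 => h2 (Subtype.ext (expOf_inj.mp h3))
      simp [h2, this]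
  · rw [if_neg h, rowL_neg h, rowL_monomial_eval]
    simp [phi, pt1, ← pow_mul, Finset.prod_pow_eq_pow_sum]

lemma rowN_alg {n d : ℕ} (s : (Fin n → ℕ) → Prop) :
    (rowN (n := n) d s).map (algebraMap _ K) = tt ^ (d * n) • rowM d s evalPt := by
  ext ν α
  simp only [Matrix.map_apply, rowN, rowM, Matrix.smul_apply]
  by_cases h : s ν.1
  · rw [if_pos h, rowL_pos h, coeff_monomial]
    by_cases h2 : α = ν
    · simp [h2, tt]
    · have : expOf α.1 ≠ expOf ν.1 := fun h3 => h2 (Subtype.ext (expOf_inj.mp h3))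
      simp [h2, this]
  · rw [if_neg h, rowL_neg h, rowL_monomial_eval, map_mul, map_pow, map_pow]
    change qq ^ _ * tt ^ _ = _
    have hle : ∑ i, kstat ν.1 i * α.1 i ≤ d * n := by
      calc _ ≤ ∑ i, n * α.1 i := Finset.sum_le_sum fun i _ => Nat.mul_le_mul_right _ (kstat_le _ _)
        _ = csize α.1 * n := by rw [← Finset.mul_sum, mul_comm]; rfl
        _ ≤ d * n := Nat.mul_le_mul_right _ α.2
    have h3 : ∏ i, evalPt ν.1 i ^ α.1 i =
        qq ^ (∑ i, ν.1 i * α.1 i) * (tt ^ (∑ i, kstat ν.1 i * α.1 i))⁻¹ := by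
      simp only [evalPt, mul_pow, Finset.prod_mul_distrib, ← pow_mul, Finset.prod_pow_eq_pow_sum,
        zpow_neg, zpow_natCast, inv_pow, Finset.prod_inv_distrib]
    rw [h3, pow_sub₀ _ tt_ne hle, smul_eq_mul]
    ring

lemma det_rowM_K {n d : ℕ} (s : (Fin n → ℕ) → Prop) (hs : ∀ ν, s ν → csize ν = d)
    (hss : ∀ ν ν', s ν → s ν' → ν = ν') : (rowM d s (evalPt (n := n))).det ≠ 0 := by
  have h1 : (rowN (n := n) d s).det ≠ 0 := by
    intro h
    apply det_rowM_one s hs hss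
    rw [← rowN_phi]
    have := RingHom.map_det phi (rowN (n := n) d s)
    rw [h, map_zero] at this
    exact this.symm
  intro h
  apply h1
  apply IsFractionRing.injective (MvPolynomial (Fin 2) ℚ) K
  rw [map_zero, RingHom.map_det]
  change ((rowN (n := n) d s).map (algebraMap _ K)).det = 0
  rw [rowN_alg, Matrix.det_smul, h, mul_zero]

lemma interp_inj {n d : ℕ} (f : MvPolynomial (Fin n) K) (hd : f.totalDegree ≤ d)
    (hf : ∀ ν : Fin n → ℕ, csize ν ≤ d → eval (evalPt ν) f = 0) : f = 0 := by
  have hdet := det_rowM_K (n := n) (d := d) (fun _ => False) (by simp) (by simp)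
  have h1 : (rowM d (fun _ => False) (evalPt (n := n))).mulVec
      (fun α => coeff (expOf α.1) f) = 0 := by
    funext ν
    rw [rowM_mulVec, ← expand_poly f hd, rowL_neg (by simp), hf _ ν.2]
    rfl
  have h2 := Matrix.eq_zero_of_mulVec_eq_zero hdet h1
  rw [expand_poly f hd]
  apply Finset.sum_eq_zero
  intro α _
  have := congrFun h2 α
  simp only [Pi.zero_apply] at this
  rw [this, map_zero]

lemma exists_Estar {n : ℕ} (μ : Fin n → ℕ) : ∃ f, IsEstar μ f := by
  have hdet := det_rowM_K (n := n) (d := csize μ) (fun ν => ν = μ) (by rintro _ rfl; rfl)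
    (by rintro _ _ rfl rfl; rfl)
  set M := rowM (csize μ) (fun ν => ν = μ) (evalPt (n := n)) with hM
  let e : CI n (csize μ) → K := fun ν => if ν.1 = μ then 1 else 0
  have hu : IsUnit M.det := isUnit_iff_ne_zero.mpr hdet
  have hc : M.mulVec (M⁻¹.mulVec e) = e := by
    rw [Matrix.mulVec_mulVec, Matrix.mul_nonsing_inv _ hu, Matrix.one_mulVec]
  set c := M⁻¹.mulVec e
  refine ⟨∑ α : CI n (csize μ), monomial (expOf α.1) (c α), ?_, ?_, ?_⟩
  · refine totalDegree_finsetSum_le fun α _ => ?_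
    refine (totalDegree_monomial_le _ _).trans ?_
    have := degree_expOf α.1
    rw [Finsupp.degree_apply] at this
    exact (le_of_eq this).trans α.2
  · have := congrFun hc ⟨μ, le_rfl⟩
    rw [hM, rowM_mulVec, rowL_pos (s := fun ν => ν = μ) rfl] at this
    rw [this]
    simp [e]
  · intro ν hν hne
    have := congrFun hc ⟨ν, hν⟩
    rw [hM, rowM_mulVec, rowL_neg (s := fun ν => ν = μ) hne] at this
    rw [this]
    simp [e, hne]

lemma Estar_spec {n : ℕ} (μ : Fin n → ℕ) : IsEstar μ (Estar μ) := by
  rw [Estar, dif_pos (exists_Estar μ)]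
  exact (exists_Estar μ).choose_spec

lemma Estar_self {n : ℕ} (μ : Fin n → ℕ) : eval (evalPt μ) (Estar μ) ≠ 0 := by
  intro h
  obtain ⟨h1, h2, h3⟩ := Estar_spec μ
  have : Estar μ = 0 := by
    apply interp_inj _ h1
    intro ν hν
    by_cases hne : ν = μ
    · rw [hne, h]
    · exact h3 ν hν hne
  rw [this] at h2
  simp at h2

/-! ### Combinatorics -/

lemma qt_ne {a b : ℕ} (h : a ≠ b) (x y : ℤ) : qq ^ a * tt ^ x ≠ qq ^ b * tt ^ y := by
  intro he
  obtain ⟨m, x', y', hx, hy⟩ : ∃ m x' y' : ℕ, x + m = x' ∧ y + m = y' :=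
    ⟨x.natAbs + y.natAbs, (x + x.natAbs + y.natAbs).toNat, (y + x.natAbs + y.natAbs).toNat,
      by omega, by omega⟩
  have h1 : qq ^ a * tt ^ x' = qq ^ b * tt ^ y' := by
    have := congrArg (fun z => z * tt ^ (m : ℤ)) he
    simp only [mul_assoc] at this
    rwa [← zpow_add₀ tt_ne, ← zpow_add₀ tt_ne, hx, hy, zpow_natCast, zpow_natCast] at this
  have h2 : (X 0 ^ a * X 1 ^ x' : MvPolynomial (Fin 2) ℚ) = X 0 ^ b * X 1 ^ y' := by
    apply IsFractionRing.injective (MvPolynomial (Fin 2) ℚ) K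
    simpa [qq, tt] using h1
  have h3 := congrArg phi h2
  simp [phi] at h3
  exact h h3

section Adj
variable {n : ℕ} (i : {i : ℕ // i + 1 < n})

/-- The index `i`. -/
def fa : Fin n := ⟨i.1, Nat.lt_of_succ_lt i.2⟩
/-- The index `i + 1`. -/
def fb : Fin n := ⟨i.1 + 1, i.2⟩

lemma fa_lt_fb : fa i < fb i := by simp [fa, fb, Fin.lt_def]

lemma adjSwap_eq : adjSwap i = Equiv.swap (fa i) (fb i) := rfl

lemma swap_lt {k j : Fin n} (h : k < j) (hne : ¬ (k = fa i ∧ j = fb i)) :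
    adjSwap i k < adjSwap i j := by
  rw [adjSwap_eq, Equiv.swap_apply_def, Equiv.swap_apply_def]
  have h1 : (fa i : ℕ) = i.1 := rfl
  have h2 : (fb i : ℕ) = i.1 + 1 := rfl
  simp only [Fin.lt_def, Fin.ext_iff] at *
  split_ifs <;> omega

lemma adj_adj (k : Fin n) : adjSwap i (adjSwap i k) = k := Equiv.swap_apply_self _ _ _

lemma adj_fa : adjSwap i (fa i) = fb i := Equiv.swap_apply_left _ _
lemma adj_fb : adjSwap i (fb i) = fa i := Equiv.swap_apply_right _ _

lemma permAct_adj (μ : Fin n → ℕ) : permAct (adjSwap i) μ = μ ∘ adjSwap i := rfl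

lemma kstat_swap {ν : Fin n → ℕ} (h : ν (fa i) ≠ ν (fb i)) (k : Fin n) :
    kstat (ν ∘ adjSwap i) k = kstat ν (adjSwap i k) := by
  rw [kstat_eq, kstat_eq]
  rw [← Set.ncard_image_of_injective _ (adjSwap i).injective]
  congr 1
  ext j
  simp only [Set.mem_image, Set.mem_ofPred_eq, Function.comp]
  have key : ∀ k j : Fin n, k < j → ν (adjSwap i k) = ν (adjSwap i j) →
      adjSwap i k < adjSwap i j := by
    intro k j hkj he
    apply swap_lt i hkj
    rintro ⟨rfl, rfl⟩
    rw [adj_fa, adj_fb] at he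
    exact h he.symm
  have key2 : ∀ k j : Fin n, k < j → ν k = ν j → adjSwap i k < adjSwap i j := by
    intro k j hkj he
    apply swap_lt i hkj
    rintro ⟨rfl, rfl⟩
    exact h he
  constructor
  · rintro ⟨j', hj', rfl⟩
    rcases hj' with hj' | ⟨h1, h2⟩
    · exact Or.inl hj'
    · exact Or.inr ⟨key _ _ h1 h2, h2⟩
  · intro hj
    refine ⟨adjSwap i j, ?_, adj_adj i j⟩
    rw [adj_adj]
    rcases hj with hj | ⟨h1, h2⟩
    · exact Or.inl hj
    · refine Or.inr ⟨?_, h2⟩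
      have := key2 _ _ h1 h2
      rwa [adj_adj] at this

lemma evalPt_swap {ν : Fin n → ℕ} (h : ν (fa i) ≠ ν (fb i)) :
    evalPt (ν ∘ adjSwap i) = evalPt ν ∘ adjSwap i := by
  funext k
  simp [evalPt, kstat_swap i h]

lemma kstat_eq_succ {ν : Fin n → ℕ} (h : ν (fa i) = ν (fb i)) :
    kstat ν (fa i) = kstat ν (fb i) + 1 := by
  rw [kstat_eq, kstat_eq, ← Set.ncard_insert_of_notMem (a := fb i)]
  · congr 1
    ext j
    simp only [Set.mem_insert_iff, Set.mem_ofPred_eq, h]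
    have h1 : (fa i : ℕ) = i.1 := rfl
    have h2 : (fb i : ℕ) = i.1 + 1 := rfl
    constructor
    · rintro (hj | ⟨hj, he⟩)
      · exact Or.inr (Or.inl hj)
      · rcases eq_or_ne j (fb i) with rfl | hne
        · exact Or.inl rfl
        · refine Or.inr (Or.inr ⟨?_, he⟩)
          simp only [Fin.lt_def, Fin.ext_iff, ne_eq] at *
          omega
    · rintro (rfl | hj | ⟨hj, he⟩)
      · exact Or.inr ⟨fa_lt_fb i, rfl⟩
      · exact Or.inl hj
      · exact Or.inr ⟨(fa_lt_fb i).trans hj, he⟩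
  · simp

lemma evalPt_eq {ν : Fin n → ℕ} (h : ν (fa i) = ν (fb i)) :
    tt * evalPt ν (fa i) = evalPt ν (fb i) := by
  rw [evalPt, evalPt, h, kstat_eq_succ i h]
  have : (-((kstat ν (fb i) : ℕ) : ℤ)) = 1 + (-((kstat ν (fb i) + 1 : ℕ) : ℤ)) := by
    push_cast; ring
  rw [this, zpow_add₀ tt_ne, zpow_one]
  ring

lemma evalPt_ne {ν : Fin n → ℕ} (h : ν (fa i) ≠ ν (fb i)) :
    evalPt ν (fa i) ≠ evalPt ν (fb i) := qt_ne h _ _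

lemma evalPt_ne' {ν : Fin n → ℕ} (h : ν (fa i) ≠ ν (fb i)) :
    tt * evalPt ν (fa i) ≠ evalPt ν (fb i) := by
  rw [evalPt, evalPt]
  have : tt * (qq ^ ν (fa i) * tt ^ (-(kstat ν (fa i) : ℤ))) =
      qq ^ ν (fa i) * tt ^ (1 + -(kstat ν (fa i) : ℤ)) := by
    rw [zpow_add₀ tt_ne, zpow_one]; ring
  rw [this]
  exact qt_ne h _ _

/-- Coinversions of a composition. -/
def invn {n : ℕ} (μ : Fin n → ℕ) : ℕ :=
  Set.ncard {p : Fin n × Fin n | p.1 < p.2 ∧ μ p.1 < μ p.2}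

lemma invn_swap {μ : Fin n → ℕ} (h : μ (fa i) < μ (fb i)) :
    invn μ = invn (μ ∘ adjSwap i) + 1 := by
  rw [invn, invn]
  have hinj : Function.Injective (Prod.map (adjSwap i) (adjSwap i)) :=
    (adjSwap i).injective.prodMap (adjSwap i).injective
  rw [← Set.ncard_image_of_injective
      {p : Fin n × Fin n | p.1 < p.2 ∧ (μ ∘ adjSwap i) p.1 < (μ ∘ adjSwap i) p.2} hinj,
    ← Set.ncard_insert_of_notMem (a := ((fa i, fb i) : Fin n × Fin n))]
  · congr 1
    ext ⟨k, j⟩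
    simp only [Set.mem_insert_iff, Set.mem_image, Set.mem_ofPred_eq, Function.comp, Prod.exists,
      Prod.map_apply, Prod.mk.injEq]
    constructor
    · rintro ⟨h1, h2⟩
      by_cases hc : k = fa i ∧ j = fb i
      · exact Or.inl hc
      · refine Or.inr ⟨adjSwap i k, adjSwap i j, ⟨swap_lt i h1 hc, ?_⟩, adj_adj i k, adj_adj i j⟩
        rwa [adj_adj, adj_adj]
    · rintro (⟨rfl, rfl⟩ | ⟨k', j', ⟨h1, h2⟩, rfl, rfl⟩)
      · exact ⟨fa_lt_fb i, h⟩
      · refine ⟨swap_lt i h1 ?_, h2⟩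
        rintro ⟨rfl, rfl⟩
        rw [adj_fa, adj_fb] at h2
        exact lt_asymm h h2
  · simp only [Set.mem_image, Set.mem_ofPred_eq, Function.comp, Prod.exists,
      Prod.map_apply, Prod.mk.injEq]
    rintro ⟨k', j', ⟨h1, h2⟩, h3, h4⟩
    have h5 : k' = fb i := by rw [← adj_adj i k', h3, adj_fa]
    have h6 : j' = fa i := by rw [← adj_adj i j', h4, adj_fb]
    rw [h5, h6] at h1
    exact lt_asymm h1 (fa_lt_fb i)

lemma comp_adj_adj (μ : Fin n → ℕ) : (μ ∘ adjSwap i) ∘ adjSwap i = μ := by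
  funext k; simp [adj_adj]

lemma comp_adj_of_eq {μ : Fin n → ℕ} (h : μ (fa i) = μ (fb i)) : μ ∘ adjSwap i = μ := by
  funext k
  simp only [Function.comp, adjSwap_eq, Equiv.swap_apply_def]
  split_ifs with h1 h2
  · rw [h1, h]
  · rw [h2, h]
  · rfl

lemma invn_le (μ : Fin n → ℕ) : invn μ ≤ invn (μ ∘ adjSwap i) + 1 := by
  rcases lt_trichotomy (μ (fa i)) (μ (fb i)) with h | h | h
  · exact (invn_swap i h).le
  · rw [comp_adj_of_eq i h]; omega
  · have := invn_swap i (μ := μ ∘ adjSwap i) (by simpa [adj_fa, adj_fb] using h)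
    rw [comp_adj_adj] at this
    omega

end Adj

lemma permAct_mul {n : ℕ} (σ τ : Equiv.Perm (Fin n)) (μ : Fin n → ℕ) :
    permAct (σ * τ) μ = permAct σ (permAct τ μ) := rfl

lemma permAct_one {n : ℕ} (μ : Fin n → ℕ) : permAct 1 μ = μ := rfl

lemma mem_Sn_self {n : ℕ} (l : Fin n → ℕ) : l ∈ Sn l := ⟨1, rfl⟩

lemma csize_of_mem {n : ℕ} {l μ : Fin n → ℕ} (h : μ ∈ Sn l) : csize μ = csize l := by
  obtain ⟨σ, rfl⟩ := h
  exact Equiv.sum_comp σ.symm l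

lemma comp_adj_mem {n : ℕ} {l μ : Fin n → ℕ} (i) (h : μ ∈ Sn l) : μ ∘ adjSwap i ∈ Sn l := by
  obtain ⟨σ, rfl⟩ := h
  exact ⟨adjSwap i * σ, rfl⟩

lemma part_unique {n : ℕ} {l l' μ : Fin n → ℕ} (hl : IsPartition l) (hl' : IsPartition l')
    (h : μ ∈ Sn l) (h' : μ ∈ Sn l') : l = l' := by
  obtain ⟨σ, hσ⟩ := h
  obtain ⟨τ, hτ⟩ := h'
  have h1 : μ ∘ σ = l := by rw [← hσ]; funext k; simp [permAct]
  have h2 : μ ∘ τ = l' := by rw [← hτ]; funext k; simp [permAct]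
  rw [← h1, ← h2]
  apply Tuple.unique_antitone
  · rw [h1]; exact fun a b hab => hl a b hab
  · rw [h2]; exact fun a b hab => hl' a b hab

lemma part_exists {n : ℕ} (μ : Fin n → ℕ) : ∃ l, IsPartition l ∧ μ ∈ Sn l := by
  refine ⟨μ ∘ Tuple.sort (OrderDual.toDual ∘ μ), ?_, Tuple.sort (OrderDual.toDual ∘ μ), ?_⟩
  · intro i j hij
    exact Tuple.monotone_sort (OrderDual.toDual ∘ μ) hij
  · funext k; simp [permAct]

lemma sortDesc_spec {n : ℕ} (μ : Fin n → ℕ) : IsPartition (sortDesc μ) ∧ μ ∈ Sn (sortDesc μ) := by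
  rw [sortDesc, dif_pos (part_exists μ)]
  exact (part_exists μ).choose_spec

lemma sortDesc_eq {n : ℕ} {l μ : Fin n → ℕ} (hl : IsPartition l) (h : μ ∈ Sn l) :
    sortDesc μ = l := part_unique (sortDesc_spec μ).1 hl (sortDesc_spec μ).2 h

lemma invn_part {n : ℕ} {l : Fin n → ℕ} (hl : IsPartition l) : invn l = 0 := by
  rw [invn, Set.ncard_eq_zero, Set.eq_empty_iff_forall_notMem]
  rintro p ⟨h1, h2⟩
  exact absurd (hl _ _ h1.le) h2.not_ge

lemma part_of_no_ascent {n : ℕ} {μ : Fin n → ℕ}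
    (h : ∀ i : {i : ℕ // i + 1 < n}, μ (fb i) ≤ μ (fa i)) : IsPartition μ := by
  have key : ∀ k a : ℕ, ∀ h : a + k < n, μ ⟨a + k, h⟩ ≤ μ ⟨a, by omega⟩ := by
    intro k
    induction k with
    | zero => intro a ha; exact le_rfl
    | succ k ih =>
      intro a ha
      exact (h ⟨a + k, ha⟩).trans (ih a (by omega))
  intro i j hij
  have hj : j = ⟨i.1 + (j.1 - i.1), by rw [Fin.le_def] at hij; omega⟩ := by
    apply Fin.ext
    rw [Fin.le_def] at hij
    simp only
    omega
  rw [hj]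
  exact key _ _ _

lemma invn_word {n : ℕ} {l : Fin n → ℕ} (hl : IsPartition l) (w : List {i : ℕ // i + 1 < n}) :
    invn (permAct (w.map adjSwap).prod l) ≤ w.length := by
  induction w with
  | nil => simp [permAct_one, invn_part hl]
  | cons i w ih =>
    rw [List.map_cons, List.prod_cons, permAct_mul, permAct_adj, List.length_cons]
    have := invn_le i (permAct (w.map adjSwap).prod l ∘ adjSwap i)
    rw [comp_adj_adj] at this
    omega

lemma word_exists {n : ℕ} {l : Fin n → ℕ} (hl : IsPartition l) (m : ℕ) :
    ∀ μ ∈ Sn l, invn μ = m → ∃ w : List {i : ℕ // i + 1 < n},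
      w.length = m ∧ permAct (w.map adjSwap).prod l = μ := by
  induction m with
  | zero =>
    intro μ hμ h0
    refine ⟨[], rfl, ?_⟩
    apply part_unique hl _ hμ (mem_Sn_self μ)
    apply part_of_no_ascent
    intro i
    by_contra hc
    push Not at hc
    have := invn_swap i hc
    omega
  | succ m ih =>
    intro μ hμ hm
    have : ∃ i : {i : ℕ // i + 1 < n}, μ (fa i) < μ (fb i) := by
      by_contra hc
      push Not at hc
      have := invn_part (part_of_no_ascent hc)
      omega
    obtain ⟨i, hi⟩ := this
    have h1 := invn_swap i hi
    obtain ⟨w, hw, hw'⟩ := ih (μ ∘ adjSwap i) (comp_adj_mem i hμ) (by omega)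
    refine ⟨i :: w, by simp [hw], ?_⟩
    rw [List.map_cons, List.prod_cons, permAct_mul, hw', permAct_adj, comp_adj_adj]

/-- The staircase partition. -/
def stair (n : ℕ) : Fin n → ℕ := fun i => n - i.1

lemma stair_lt {n : ℕ} (a b : Fin n) : stair n a < stair n b ↔ b < a := by
  simp only [stair, Fin.lt_def]; omega

lemma stair_part (n : ℕ) : IsPartition (stair n) := by
  intro i j hij
  rw [Fin.le_def] at hij
  simp only [stair]; omega

lemma stair_inj (n : ℕ) : Function.Injective (stair n) := by
  intro i j hij
  simp only [stair] at hij
  apply Fin.ext; omega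

lemma invn_eq_aux {n : ℕ} (l : Fin n → ℕ) (σ : Equiv.Perm (Fin n)) :
    invn (permAct σ l) = Set.ncard {p : Fin n × Fin n | σ p.2 < σ p.1 ∧ l p.2 < l p.1} := by
  have hinj : Function.Injective
      (fun p : Fin n × Fin n => ((σ p.2, σ p.1) : Fin n × Fin n)) := by
    rintro ⟨a, b⟩ ⟨c, d⟩ h
    simp only [Prod.mk.injEq, EmbeddingLike.apply_eq_iff_eq] at h
    rw [h.1, h.2]
  rw [← Set.ncard_image_of_injective _ hinj, invn]
  congr 1
  ext ⟨a, b⟩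
  simp only [Set.mem_image, Set.mem_ofPred_eq, Prod.exists, Prod.mk.injEq, permAct, Function.comp]
  constructor
  · rintro ⟨h1, h2⟩
    exact ⟨σ.symm b, σ.symm a, ⟨by simpa using h1, h2⟩, by simp, by simp⟩
  · rintro ⟨x, y, ⟨h1, h2⟩, rfl, rfl⟩
    exact ⟨h1, by simpa using h2⟩

lemma invn_stair {n : ℕ} (σ : Equiv.Perm (Fin n)) :
    invn (permAct σ (stair n)) = permLength σ := by
  rw [invn_eq_aux, permLength]
  congr 1
  ext p
  simp only [Set.mem_ofPred_eq, stair_lt]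
  exact and_comm

lemma invn_le_permLength {n : ℕ} {l : Fin n → ℕ} (hl : IsPartition l) (σ : Equiv.Perm (Fin n)) :
    invn (permAct σ l) ≤ permLength σ := by
  rw [invn_eq_aux, permLength]
  apply Set.ncard_le_ncard _ (Set.toFinite _)
  rintro p ⟨h1, h2⟩
  refine ⟨?_, h1⟩
  by_contra hc
  exact absurd (hl _ _ (not_lt.mp hc)) h2.not_ge

lemma permLength_word {n : ℕ} (w : List {i : ℕ // i + 1 < n}) :
    permLength (w.map adjSwap).prod ≤ w.length := by
  rw [← invn_stair]
  exact invn_word (stair_part n) w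

lemma reduced_exists {n : ℕ} (σ : Equiv.Perm (Fin n)) : ∃ w, IsReducedWordOf w σ := by
  obtain ⟨w, h1, h2⟩ := word_exists (stair_part n) _ (permAct σ (stair n)) ⟨σ, rfl⟩ rfl
  refine ⟨w, ?_, by rw [h1, invn_stair]⟩
  have : (w.map adjSwap).prod.symm = σ.symm := by
    ext k
    have := stair_inj n (congrFun h2 k)
    rw [this]
  exact Equiv.symm_bijective.injective this

lemma sigmaMin_spec {n : ℕ} {l μ : Fin n → ℕ} (hl : IsPartition l) (h : μ ∈ Sn l) :
    permAct (sigmaMin l μ) l = μ ∧ permLength (sigmaMin l μ) = invn μ := by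
  have hex : ∃ σ, permAct σ l = μ ∧ ∀ τ, permAct τ l = μ → permLength σ ≤ permLength τ := by
    obtain ⟨σ0, hσ0⟩ := h
    obtain ⟨σ, hσ, hmin⟩ := Finset.exists_min_image
      (Finset.univ.filter fun σ : Equiv.Perm (Fin n) => permAct σ l = μ) permLength
      ⟨σ0, by simpa using hσ0⟩
    exact ⟨σ, by simpa using hσ, fun τ hτ => hmin τ (by simpa using hτ)⟩
  rw [sigmaMin, dif_pos hex]
  obtain ⟨h1, h2⟩ := hex.choose_spec
  refine ⟨h1, le_antisymm ?_ ?_⟩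
  · obtain ⟨w, hw, hw'⟩ := word_exists hl _ μ h rfl
    exact (h2 _ hw').trans ((permLength_word w).trans hw.le)
  · have := invn_le_permLength hl hex.choose
    rwa [h1] at this

/-! ### Hecke operators -/

lemma dvd_swap {n : ℕ} (i j : Fin n) (f : MvPolynomial (Fin n) K) :
    ∃ g, f - swapVars i j f = (X i - X j) * g := by
  have : (X i - X j : MvPolynomial (Fin n) K) ∣ f - swapVars i j f := by
    rw [← Ideal.mem_span_singleton, ← Ideal.Quotient.eq]
    set I : Ideal (MvPolynomial (Fin n) K) := Ideal.span {X i - X j}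
    have hX : Ideal.Quotient.mk I (X i) = Ideal.Quotient.mk I (X j) := by
      rw [Ideal.Quotient.eq]
      exact Ideal.mem_span_singleton_self _
    have h : (Ideal.Quotient.mkₐ K I) = (Ideal.Quotient.mkₐ K I).comp (rename (Equiv.swap i j)) := by
      apply MvPolynomial.algHom_ext
      intro k
      simp only [AlgHom.comp_apply, rename_X, Ideal.Quotient.mkₐ_eq_mk]
      rw [Equiv.swap_apply_def]
      split_ifs with h1 h2
      · rw [h1, hX]
      · rw [h2, hX]
      · rfl
    exact DFunLike.congr_fun h f
  exact this

lemma exactDiv_spec {n : ℕ} (i j : Fin n) (f : MvPolynomial (Fin n) K) :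
    f - swapVars i j f = (X i - X j) * exactDiv (f - swapVars i j f) (X i - X j) := by
  have h := dvd_swap i j f
  rw [exactDiv, dif_pos h]
  exact h.choose_spec

lemma totalDegree_heckeAt {n : ℕ} (i : {i : ℕ // i + 1 < n}) (f : MvPolynomial (Fin n) K) :
    (heckeAt i f).totalDegree ≤ f.totalDegree := by
  change (hecke (fa i) (fb i) f).totalDegree ≤ _
  have hne : fa i ≠ fb i := (fa_lt_fb i).ne
  have hs := exactDiv_spec (fa i) (fb i) f
  rw [hecke]
  generalize exactDiv (f - swapVars (fa i) (fb i) f) (X (fa i) - X (fb i)) = g at hs ⊢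
  refine (totalDegree_sub _ _).trans (max_le ?_ ?_)
  · exact (totalDegree_mul _ _).trans (by simp)
  · by_cases hg : g = 0
    · simp [hg]
    · have hXd : 1 ≤ (X (fa i) - X (fb i) : MvPolynomial (Fin n) K).totalDegree := by
        have : Finsupp.single (fa i) 1 ∈
            (X (fa i) - X (fb i) : MvPolynomial (Fin n) K).support := by
          rw [mem_support_iff, coeff_sub, coeff_X, coeff_X, if_pos rfl, if_neg]
          · simp
          · intro h
            exact hne.symm (Finsupp.single_left_injective one_ne_zero h)
        have := le_totalDegree this
        simpa using this
      have hX0 : (X (fa i) - X (fb i) : MvPolynomial (Fin n) K) ≠ 0 := by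
        intro h
        rw [h] at hXd
        simp at hXd
      have h1 := congrArg totalDegree hs
      rw [totalDegree_mul_of_isDomain hX0 hg] at h1
      have h2 : (f - swapVars (fa i) (fb i) f).totalDegree ≤ f.totalDegree :=
        (totalDegree_sub _ _).trans (max_le le_rfl (totalDegree_rename_le _ _))
      have h3 : (C tt * X (fa i) - X (fb i) : MvPolynomial (Fin n) K).totalDegree ≤ 1 :=
        (totalDegree_sub _ _).trans (max_le ((totalDegree_mul _ _).trans (by simp)) (by simp))
      have h4 := totalDegree_mul (C tt * X (fa i) - X (fb i) : MvPolynomial (Fin n) K) g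
      omega

lemma eval_hecke_eq {n : ℕ} (i : {i : ℕ // i + 1 < n}) (f : MvPolynomial (Fin n) K)
    {ν : Fin n → ℕ} (h : ν (fa i) = ν (fb i)) :
    eval (evalPt ν) (heckeAt i f) = tt * eval (evalPt ν) f := by
  change eval (evalPt ν) (hecke (fa i) (fb i) f) = _
  rw [hecke]
  simp [evalPt_eq i h]

lemma eval_hecke_ne {n : ℕ} (i : {i : ℕ // i + 1 < n}) {ν : Fin n → ℕ}
    (h : ν (fa i) ≠ ν (fb i)) : ∃ a b : K, b ≠ 0 ∧ ∀ f : MvPolynomial (Fin n) K,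
    eval (evalPt ν) (heckeAt i f) =
      a * eval (evalPt ν) f + b * eval (evalPt (ν ∘ adjSwap i)) f := by
  have hd : evalPt ν (fa i) - evalPt ν (fb i) ≠ 0 := sub_ne_zero.mpr (evalPt_ne i h)
  have hd' : tt * evalPt ν (fa i) - evalPt ν (fb i) ≠ 0 := sub_ne_zero.mpr (evalPt_ne' i h)
  set r := (tt * evalPt ν (fa i) - evalPt ν (fb i)) / (evalPt ν (fa i) - evalPt ν (fb i)) with hr
  refine ⟨tt - r, r, div_ne_zero hd' hd, fun f => ?_⟩
  change eval (evalPt ν) (hecke (fa i) (fb i) f) = _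
  have hs := congrArg (eval (evalPt ν)) (exactDiv_spec (fa i) (fb i) f)
  rw [hecke]
  generalize exactDiv (f - swapVars (fa i) (fb i) f) (X (fa i) - X (fb i)) = g at hs ⊢
  rw [swapVars] at hs
  simp only [map_sub, map_mul, eval_X, eval_rename, eval_C] at hs ⊢
  rw [evalPt_swap i h]
  have hs' : eval (evalPt ν) g = (eval (evalPt ν) f - eval (evalPt ν ∘ adjSwap i) f) /
      (evalPt ν (fa i) - evalPt ν (fb i)) := by
    rw [eq_div_iff hd, mul_comm, ← hs]
    rfl
  rw [hs', hr]
  field_simp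
  ring

lemma mem_Vstar {n : ℕ} {l : Fin n → ℕ} {f : MvPolynomial (Fin n) K} :
    f ∈ Vstar l ↔ f.totalDegree ≤ csize l ∧
      ∀ ν : Fin n → ℕ, csize ν ≤ csize l → ν ∉ Sn l → eval (evalPt ν) f = 0 := by
  simp [Vstar, mem_restrictTotalDegree, aeval_eq_eval, Submodule.mem_iInf]

lemma heckeAt_mem {n : ℕ} {l : Fin n → ℕ} (i) {f : MvPolynomial (Fin n) K} (hf : f ∈ Vstar l) :
    heckeAt i f ∈ Vstar l := by
  rw [mem_Vstar] at hf ⊢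
  refine ⟨(totalDegree_heckeAt i f).trans hf.1, fun ν h1 h2 => ?_⟩
  by_cases h : ν (fa i) = ν (fb i)
  · rw [eval_hecke_eq i f h, hf.2 ν h1 h2, mul_zero]
  · obtain ⟨a, b, -, hab⟩ := eval_hecke_ne i h
    have h3 : ν ∘ adjSwap i ∉ Sn l := by
      intro h3
      have := comp_adj_mem i h3
      rw [comp_adj_adj] at this
      exact h2 this
    have h4 : csize (ν ∘ adjSwap i) ≤ csize l := by
      rw [csize_of_mem (l := ν) (comp_adj_mem i (mem_Sn_self ν))]
      exact h1
    rw [hab, hf.2 ν h1 h2, hf.2 _ h4 h3, mul_zero, mul_zero, add_zero]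

lemma Tword_mem {n : ℕ} {l : Fin n → ℕ} (w) {f : MvPolynomial (Fin n) K} (hf : f ∈ Vstar l) :
    Tword w f ∈ Vstar l := by
  induction w with
  | nil => exact hf
  | cons i w ih => exact heckeAt_mem i ih

lemma Estar_mem {n : ℕ} (l : Fin n → ℕ) : Estar l ∈ Vstar l := by
  obtain ⟨h1, -, h3⟩ := Estar_spec l
  rw [mem_Vstar]
  refine ⟨h1, fun ν hν hn => h3 ν hν ?_⟩
  rintro rfl
  exact hn (mem_Sn_self ν)

lemma Tword_support {n : ℕ} {l : Fin n → ℕ} (hl : IsPartition l) (w : List {i : ℕ // i + 1 < n}) :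
    ∀ ν ∈ Sn l, w.length ≤ invn ν → eval (evalPt ν) (Tword w (Estar l)) ≠ 0 →
      permAct (w.map adjSwap).prod l = ν ∧ invn ν = w.length := by
  induction w with
  | nil =>
    intro ν hν _ h0
    have : ν = l := by
      by_contra hne
      exact h0 ((Estar_spec l).2.2 ν (csize_of_mem hν).le hne)
    subst this
    exact ⟨rfl, invn_part hl⟩
  | cons i w ih =>
    intro ν hν hlen h0
    rw [List.length_cons] at hlen
    have hz : eval (evalPt ν) (Tword w (Estar l)) = 0 := by
      by_contra hc
      have := (ih ν hν (by omega) hc).2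
      omega
    change eval (evalPt ν) (heckeAt i (Tword w (Estar l))) ≠ 0 at h0
    by_cases h : ν (fa i) = ν (fb i)
    · rw [eval_hecke_eq i _ h, hz, mul_zero] at h0
      exact absurd rfl h0
    · obtain ⟨a, b, -, hab⟩ := eval_hecke_ne i h
      rw [hab, hz, mul_zero, zero_add] at h0
      have h1 := invn_le i ν
      obtain ⟨h2, h3⟩ := ih (ν ∘ adjSwap i) (comp_adj_mem i hν) (by omega) (right_ne_zero_of_mul h0)
      refine ⟨?_, by rw [List.length_cons]; omega⟩
      rw [List.map_cons, List.prod_cons, permAct_mul, h2, permAct_adj, comp_adj_adj]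

lemma Tword_diag {n : ℕ} {l : Fin n → ℕ} (hl : IsPartition l) (w : List {i : ℕ // i + 1 < n}) :
    invn (permAct (w.map adjSwap).prod l) = w.length →
      eval (evalPt (permAct (w.map adjSwap).prod l)) (Tword w (Estar l)) ≠ 0 := by
  induction w with
  | nil => intro _; exact Estar_self l
  | cons i w ih =>
    intro hlen
    have hle := invn_word hl w
    set μ := permAct (w.map adjSwap).prod l with hμ
    have hcons : permAct ((i :: w).map adjSwap).prod l = μ ∘ adjSwap i := by
      rw [List.map_cons, List.prod_cons, permAct_mul, permAct_adj]
    rw [hcons, List.length_cons] at hlen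
    rw [hcons]
    set ν := μ ∘ adjSwap i with hν
    have h1 := invn_le i ν
    have hμν : ν ∘ adjSwap i = μ := comp_adj_adj i μ
    rw [hμν] at h1
    have hz : eval (evalPt ν) (Tword w (Estar l)) = 0 := by
      by_contra hc
      have := (Tword_support hl w ν (comp_adj_mem i ⟨_, hμ.symm⟩) (by omega) hc).2
      omega
    have h : ν (fa i) ≠ ν (fb i) := by
      intro h
      have := comp_adj_of_eq i h
      rw [hμν] at this
      rw [this] at hle
      omega
    change eval (evalPt ν) (heckeAt i (Tword w (Estar l))) ≠ 0
    obtain ⟨a, b, hb, hab⟩ := eval_hecke_ne i h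
    rw [hab, hz, mul_zero, zero_add, hμν]
    exact mul_ne_zero hb (ih (by omega))

lemma fstar_word {n : ℕ} {l μ : Fin n → ℕ} (hl : IsPartition l) (h : μ ∈ Sn l) :
    ∃ w : List {i : ℕ // i + 1 < n}, fstar μ = Tword w (Estar l) ∧
      permAct (w.map adjSwap).prod l = μ ∧ w.length = invn μ := by
  rw [fstar, sortDesc_eq hl h]
  obtain ⟨h1, h2⟩ := sigmaMin_spec hl h
  have hr := reduced_exists (sigmaMin l μ)
  rw [Tsigma, dif_pos hr]
  obtain ⟨h3, h4⟩ := hr.choose_spec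
  exact ⟨hr.choose, rfl, by rw [h3, h1], by rw [h4, h2]⟩

lemma fstar_mem {n : ℕ} {l μ : Fin n → ℕ} (hl : IsPartition l) (h : μ ∈ Sn l) :
    fstar μ ∈ Vstar l := by
  obtain ⟨w, h1, -⟩ := fstar_word hl h
  rw [h1]
  exact Tword_mem w (Estar_mem l)

lemma fstar_diag {n : ℕ} (μ : Fin n → ℕ) : eval (evalPt μ) (fstar μ) ≠ 0 := by
  obtain ⟨hl, h⟩ := sortDesc_spec μ
  obtain ⟨w, h1, h2, h3⟩ := fstar_word hl h
  have := Tword_diag hl w (by rw [h2, h3])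
  rwa [h2, ← h1] at this

lemma fstar_tri {n : ℕ} {μ ν : Fin n → ℕ} (hs : csize ν ≤ csize μ)
    (h0 : eval (evalPt ν) (fstar μ) ≠ 0) (hi : csize ν = csize μ → invn μ ≤ invn ν) : ν = μ := by
  obtain ⟨hl, h⟩ := sortDesc_spec μ
  have hν : ν ∈ Sn (sortDesc μ) := by
    by_contra hc
    exact h0 ((mem_Vstar.mp (fstar_mem hl h)).2 ν (by rwa [← csize_of_mem h]) hc)
  obtain ⟨w, h1, h2, h3⟩ := fstar_word hl h
  rw [h1] at h0
  have := (Tword_support hl w ν hν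
    (by rw [h3]; exact hi (by rw [csize_of_mem h, csize_of_mem hν])) h0).1
  rw [← this, h2]

lemma fstar_li (n : ℕ) : LinearIndependent K (fun μ : Fin n → ℕ => fstar μ) := by
  rw [linearIndependent_iff']
  intro s c hc
  by_contra hne
  push Not at hne
  obtain ⟨μ0, hμ0, hcμ0⟩ := hne
  obtain ⟨μ, hμ, hmin⟩ := Finset.exists_min_image (s.filter fun μ => c μ ≠ 0)
    (fun μ => toLex (csize μ, OrderDual.toDual (invn μ))) ⟨μ0, by simp [hμ0, hcμ0]⟩
  simp only [Finset.mem_filter] at hμ hmin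
  have h1 := congrArg (eval (evalPt μ)) hc
  rw [map_sum, map_zero, Finset.sum_eq_single_of_mem μ hμ.1] at h1
  · rw [smul_eval] at h1
    exact mul_ne_zero hμ.2 (fstar_diag μ) h1
  · intro μ' hμ' hne
    rw [smul_eval]
    by_cases hz : c μ' = 0
    · rw [hz, zero_mul]
    · by_contra h2
      have h3 := hmin μ' ⟨hμ', hz⟩
      rw [Prod.Lex.toLex_le_toLex] at h3
      apply hne
      symm
      apply fstar_tri _ (right_ne_zero_of_mul h2)
      · intro he
        rcases h3 with h3 | h3
        · exact absurd he h3.ne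
        · exact h3.2
      · rcases h3 with h3 | h3
        · exact h3.le
        · exact h3.1.le

lemma span_abstract {F V ι : Type*} [Field F] [AddCommGroup V] [Module F V] (W : Submodule F V)
    [Fintype ι] (v : ι → V) (ev : ι → V →ₗ[F] F) (hv : LinearIndependent F v)
    (hmem : ∀ i, v i ∈ W) (hinj : ∀ f ∈ W, (∀ i, ev i f = 0) → f = 0) :
    Submodule.span F (Set.range v) = W := by
  let e : W →ₗ[F] (ι → F) := LinearMap.pi fun i => ev i ∘ₗ W.subtype
  have he : Function.Injective e := by
    rw [← LinearMap.ker_eq_bot, LinearMap.ker_eq_bot']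
    intro f hf
    apply Subtype.ext
    apply hinj f.1 f.2
    intro i
    exact congrFun hf i
  have : Module.Finite F W := Module.Finite.of_injective e he
  let b : ι → W := fun i => ⟨v i, hmem i⟩
  have hb : LinearIndependent F b := LinearIndependent.of_comp W.subtype hv
  have hcard : Fintype.card ι = Module.finrank F W := by
    apply le_antisymm hb.fintype_card_le_finrank
    have := LinearMap.finrank_le_finrank_of_injective he
    simpa using this
  have hspan := hb.span_eq_top_of_card_eq_finrank' hcard
  have := congrArg (Submodule.map W.subtype) hspan
  rw [Submodule.map_span, Submodule.map_top, Submodule.range_subtype, ← Set.range_comp] at this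
  exact this

lemma span_of_inj {n : ℕ} (W : Submodule K (MvPolynomial (Fin n) K)) (S : Set (Fin n → ℕ))
    (hS : S.Finite) (hmem : ∀ μ ∈ S, fstar μ ∈ W)
    (hinj : ∀ f ∈ W, (∀ ν ∈ S, eval (evalPt ν) f = 0) → f = 0) :
    Submodule.span K ((fun μ : Fin n → ℕ => fstar μ) '' S) = W := by
  have : Fintype S := hS.fintype
  have h := span_abstract W (fun μ : S => fstar μ.1)
    (fun ν => (aeval (R := K) (evalPt ν.1)).toLinearMap)
    ((fstar_li n).comp (fun μ : S => μ.1) Subtype.val_injective)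
    (fun μ => hmem μ.1 μ.2)
    (fun f hf h0 => hinj f hf fun ν hν => by
      have := h0 ⟨ν, hν⟩
      rwa [AlgHom.toLinearMap_apply, aeval_eq_eval] at this)
  rw [Set.image_eq_range]
  exact h

theorem statement6 (n : ℕ) (hn : 1 ≤ n) (l : Fin n → ℕ) (hl : IsPartition l) :
    (LinearIndependent K (fun μ : {μ : Fin n → ℕ // μ ∈ Sn l} => fstar μ.1) ∧
      Submodule.span K ((fun μ : Fin n → ℕ => fstar μ) '' Sn l) = Vstar l) ∧
    (LinearIndependent K (fun μ : Fin n → ℕ => fstar μ) ∧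
      Submodule.span K (Set.range (fun μ : Fin n → ℕ => fstar (n := n) μ)) = ⊤) := by
  refine ⟨⟨(fstar_li n).comp (fun μ : {μ : Fin n → ℕ // μ ∈ Sn l} => μ.1) Subtype.val_injective,
    ?_⟩, fstar_li n, ?_⟩
  · apply span_of_inj
    · exact (finite_csize n (csize l)).subset fun μ hμ => (csize_of_mem hμ).le
    · exact fun μ hμ => fstar_mem hl hμ
    · intro f hf h0
      rw [mem_Vstar] at hf
      apply interp_inj f hf.1
      intro ν hν
      by_cases h : ν ∈ Sn l
      · exact h0 ν h
      · exact hf.2 ν hν h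
  · rw [eq_top_iff]
    intro f _
    have h := span_of_inj (restrictTotalDegree (Fin n) K f.totalDegree)
      {ν | csize ν ≤ f.totalDegree} (finite_csize n _)
      (fun μ hμ => by
        obtain ⟨h1, h2⟩ := sortDesc_spec μ
        rw [mem_restrictTotalDegree]
        refine (mem_Vstar.mp (fstar_mem h1 h2)).1.trans ?_
        rw [← csize_of_mem h2]
        exact hμ)
      (fun g hg h0 => by
        rw [mem_restrictTotalDegree] at hg
        exact interp_inj g hg h0)
    have hf : f ∈ restrictTotalDegree (Fin n) K f.totalDegree := by
      rw [mem_restrictTotalDegree]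
    rw [← h] at hf
    exact Submodule.span_mono (Set.image_subset_range _ _) hf
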